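/- Let p be an odd prime and let d = p - ε(p). Let r, k be integers with 1 ≤ k ≤ r. Then p divides H(r,k) whenever one of the following holds (congruences mod d, read in the integers): (i) r ≡ 1 and k ≡ 1; (ii) r ≡ -2 and k ≡ 0; (iii) r ≡ -2 and k ≡ -1; (iv) r ≡ -5 and k ≡ -2. -/

import Mathlib

/-- Entry of the determinant Hosoya triangle. -/
def detHosoya (r k : ℕ) : ℕ :=
  Nat.fib (k - 1) * Nat.fib (r - k + 2) + Nat.fib k * Nat.fib (r - k)

/-- `p - ε(p)` where `ε(p)` is the Legendre symbol `(5/p)`. -/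
def dP (p : ℕ) : ℕ :=
  if p % 5 = 1 ∨ p % 5 = 4 then p - 1
  else if p % 5 = 2 ∨ p % 5 = 3 then p + 1
  else p

open Polynomial in
/-- An algebraically closed field contains a root of `X ^ 2 - X - 1`. -/
theorem exists_sq_eq_self_add_one (K : Type*) [Field K] [IsAlgClosed K] :
    ∃ a : K, a ^ 2 = a + 1 := by
  have hdeg : (X ^ 2 - X - 1 : K[X]).degree = 2 := by compute_degree!
  obtain ⟨a, ha⟩ := IsAlgClosed.exists_root (X ^ 2 - X - 1 : K[X]) (by rw [hdeg]; decide)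
  refine ⟨a, ?_⟩
  simp only [IsRoot.def, eval_sub, eval_pow, eval_X, eval_one] at ha
  linear_combination ha

/-- Binet's formula in a commutative ring. -/
theorem binet_of_sq_eq {R : Type*} [CommRing R] {a : R} (ha : a ^ 2 = a + 1) (n : ℕ) :
    (2 * a - 1) * (Nat.fib n : R) = a ^ n - (1 - a) ^ n := by
  induction n using Nat.twoStepInduction with
  | zero => simp
  | one => simp; ring
  | more n h₀ h₁ =>
    rw [Nat.fib_add_two, Nat.cast_add, mul_add, h₀, h₁]
    linear_combination ((1 - a) ^ n - a ^ n) * ha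

theorem legendreSym_five {p : ℕ} [Fact p.Prime] (hp2 : p ≠ 2) :
    (p % 5 = 1 ∨ p % 5 = 4 → legendreSym p 5 = 1) ∧
      (p % 5 = 2 ∨ p % 5 = 3 → legendreSym p 5 = -1) := by
  have : Fact (Nat.Prime 5) := ⟨Nat.prime_five⟩
  have h := legendreSym.quadratic_reciprocity_one_mod_four (p := 5) (q := p) (by norm_num) hp2
  rw [legendreSym.mod 5 p, ← Int.natCast_mod, Nat.cast_ofNat] at h
  rw [h]
  constructor <;> rintro (hp | hp) <;> rw [hp] <;> clear * - this <;> decide +revert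

theorem prime_dvd_fib_dP {p : ℕ} (hp : p.Prime) (hodd : Odd p) : p ∣ Nat.fib (dP p) := by
  have : Fact p.Prime := ⟨hp⟩
  have hp2 : p ≠ 2 := by rintro rfl; exact absurd hodd (by decide)
  by_cases hp5 : p = 5
  · subst hp5; decide
  have hmod : p % 5 ≠ 0 := fun h =>
    hp5 ((Nat.prime_dvd_prime_iff_eq (by norm_num) hp).1 (Nat.dvd_of_mod_eq_zero h)).symm
  let K := AlgebraicClosure (ZMod p)
  have : CharP K p := charP_of_injective_algebraMap (algebraMap (ZMod p) K).injective p
  obtain ⟨a, ha⟩ := exists_sq_eq_self_add_one K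
  have natCast_ne_zero {q : ℕ} (hq : q.Prime) (hpq : p ≠ q) : (q : K) ≠ 0 := by
    rw [Ne, CharP.cast_eq_zero_iff K p, Nat.prime_dvd_prime_iff_eq hp hq]
    exact hpq
  have h2 : (2 : K) ≠ 0 := by exact_mod_cast natCast_ne_zero Nat.prime_two hp2
  have h5 : (5 : K) ≠ 0 := by exact_mod_cast natCast_ne_zero Nat.prime_five hp5
  have hs : (2 * a - 1) ^ 2 = 5 := by linear_combination 4 * ha
  have hs0 : 2 * a - 1 ≠ 0 := by
    intro h
    rw [h] at hs
    exact h5 (by rw [← hs]; ring)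
  have htwo : (2 : K) ^ p = 2 := by
    simpa only [map_pow, map_ofNat] using
      congrArg (algebraMap (ZMod p) K) (ZMod.pow_card (2 : ZMod p))
  have hfrob : 2 * a ^ p - 1 = (legendreSym p 5 : K) * (2 * a - 1) := by
    have hχ : (legendreSym p 5 : K) = 5 ^ (p / 2) := by
      simpa only [map_pow, map_intCast, Int.cast_ofNat, map_ofNat] using
        congrArg (algebraMap (ZMod p) K) (legendreSym.eq_pow p 5)
    calc 2 * a ^ p - 1 = (2 * a - 1) ^ p := by
          rw [sub_pow_char, mul_pow, htwo, one_pow]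
      _ = (2 * a - 1) ^ (2 * (p / 2) + 1) := by
          rw [Nat.two_mul_div_two_add_one_of_odd hodd]
      _ = _ := by rw [pow_succ, pow_mul, hs, hχ]
  have hconj : (1 - a) ^ p = 1 - a ^ p := by rw [sub_pow_char, one_pow]
  have ha0 : a ≠ 0 := by rintro rfl; simp at ha
  have hb0 : 1 - a ≠ 0 := by
    intro h
    have : a = 1 := by linear_combination -h
    subst this
    simp at ha
  rw [← CharP.cast_eq_zero_iff K p]
  refine (mul_eq_zero.1 ?_).resolve_left hs0
  rw [binet_of_sq_eq ha, sub_eq_zero]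
  have hcases : (p % 5 = 1 ∨ p % 5 = 4) ∨ (p % 5 = 2 ∨ p % 5 = 3) := by omega
  rcases hcases with h | h
  · have hχ : legendreSym p 5 = 1 := (legendreSym_five hp2).1 h
    have hap : a ^ p = a := by
      refine mul_left_cancel₀ h2 ?_
      rw [hχ] at hfrob
      push_cast at hfrob
      linear_combination hfrob
    have pow_pred {x : K} (hx : x ≠ 0) (hxp : x ^ p = x) : x ^ (p - 1) = 1 := by
      refine mul_right_cancel₀ hx ?_
      rw [← pow_succ, Nat.sub_add_cancel hp.one_le, hxp, one_mul]
    rw [dP, if_pos h, pow_pred ha0 hap, pow_pred hb0 (by rw [hconj, hap])]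
  · have hχ : legendreSym p 5 = -1 := (legendreSym_five hp2).2 h
    have hap : a ^ p = 1 - a := by
      refine mul_left_cancel₀ h2 ?_
      rw [hχ] at hfrob
      push_cast at hfrob
      linear_combination hfrob
    rw [dP, if_neg (by omega), if_pos h, pow_succ, pow_succ, hconj, hap]
    ring

/-- Modulo a divisor of `F d`, shifting the index by a multiple of `d` scales Fibonacci numbers. -/
theorem intFib_add_modEq {p : ℤ} {n : ℤ} (h : p ∣ Int.fib n) (j : ℤ) :
    Int.fib (n + j) ≡ Int.fib (n - 1) * Int.fib j [ZMOD p] := by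
  rw [Int.fib_add]
  exact (Int.modEq_iff_dvd.2 (by simpa using h.mul_right (Int.fib (j + 1)))).symm

theorem detHosoya_cast {r k : ℕ} (hk : 1 ≤ k) (hkr : k ≤ r) :
    (detHosoya r k : ℤ) = Int.fib ((k : ℤ) - 1) * Int.fib ((r : ℤ) - k + 2) +
      Int.fib k * Int.fib ((r : ℤ) - k) := by
  have h₁ : (k : ℤ) - 1 = (k - 1 : ℕ) := by omega
  have h₂ : (r : ℤ) - k = (r - k : ℕ) := by omega
  have h₃ : (r : ℤ) - k + 2 = (r - k + 2 : ℕ) := by omega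
  rw [h₁, h₃, h₂]
  simp only [Int.fib_natCast]
  rw [detHosoya, Nat.cast_add, Nat.cast_mul, Nat.cast_mul]

theorem dvd_detHosoya_of_modEq {p d r k : ℕ} (hk : 1 ≤ k) (hkr : k ≤ r) (hd : p ∣ Nat.fib d)
    {a b : ℤ} (hr : (r : ℤ) ≡ b [ZMOD d]) (hka : (k : ℤ) ≡ a [ZMOD d])
    (hab : Int.fib (a - 1) * Int.fib (b - a + 2) + Int.fib a * Int.fib (b - a) = 0) :
    p ∣ detHosoya r k := by
  have dvd_fib {n : ℤ} (hn : (d : ℤ) ∣ n) : (p : ℤ) ∣ Int.fib n :=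
    (Int.natCast_dvd_natCast.2 hd).trans (by simpa using Int.fib_dvd d n hn)
  have hm : (p : ℤ) ∣ Int.fib (k - a) := dvd_fib hka.symm.dvd
  have hn : (p : ℤ) ∣ Int.fib ((r - k) - (b - a)) := dvd_fib (hr.sub hka).symm.dvd
  rw [← Int.natCast_dvd_natCast, detHosoya_cast hk hkr, ← Int.modEq_zero_iff_dvd]
  have e₁ := intFib_add_modEq hm (a - 1)
  have e₂ := intFib_add_modEq hm a
  have e₃ := intFib_add_modEq hn (b - a + 2)
  have e₄ := intFib_add_modEq hn (b - a)
  rw [show (k : ℤ) - a + (a - 1) = k - 1 by ring] at e₁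
  rw [show (k : ℤ) - a + a = k by ring] at e₂
  rw [show (r : ℤ) - k - (b - a) + (b - a + 2) = r - k + 2 by ring] at e₃
  rw [show (r : ℤ) - k - (b - a) + (b - a) = r - k by ring] at e₄
  refine ((e₁.mul e₃).add (e₂.mul e₄)).trans (congrArg (· % (p : ℤ)) ?_)
  linear_combination Int.fib (k - a - 1) * Int.fib (r - k - (b - a) - 1) * hab

theorem detHosoya_composite_points (p r k : ℕ) (hp : p.Prime) (hodd : Odd p)
    (hk : 1 ≤ k) (hkr : k ≤ r)
    (h : ((r : ℤ) ≡ 1 [ZMOD (dP p)] ∧ (k : ℤ) ≡ 1 [ZMOD (dP p)]) ∨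
         ((r : ℤ) ≡ -2 [ZMOD (dP p)] ∧ (k : ℤ) ≡ 0 [ZMOD (dP p)]) ∨
         ((r : ℤ) ≡ -2 [ZMOD (dP p)] ∧ (k : ℤ) ≡ -1 [ZMOD (dP p)]) ∨
         ((r : ℤ) ≡ -5 [ZMOD (dP p)] ∧ (k : ℤ) ≡ -2 [ZMOD (dP p)])) :
    p ∣ detHosoya r k := by
  have hd := prime_dvd_fib_dP hp hodd
  rcases h with ⟨hr, hk'⟩ | ⟨hr, hk'⟩ | ⟨hr, hk'⟩ | ⟨hr, hk'⟩ <;>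
    exact dvd_detHosoya_of_modEq hk hkr hd hr hk' (by decide)
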